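/- Define the RPST distribution P_RPS(n|N) = P(N,n)·(F(n)−1) / Σ_{i=1}^{N}[P(N,i)·(F(i)−1)] for 1 ≤ n ≤ N. Then lim_{N→∞} P_RPS(N|N) = 1; that is, as N → ∞ the RPST distribution concentrates all probability on permutation sequences of maximal length n = N. -/

import Mathlib

/-- P(n,i) = n!/(n−i)!, the number of i-permutations of n (the division is exact for i ≤ n). -/
def P (n i : ℕ) : ℕ := n.factorial / (n - i).factorial

/-- F(i) = Σ_{j=0}^{i} P(i,j), the total number of permutation events over i elements. -/
def F (i : ℕ) : ℕ := ∑ j ∈ Finset.range (i + 1), P i j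

/-- The RPST distribution: P_RPS(n|N) = P(N,n)·(F(n)−1) / Σ_{i=1}^{N}[P(N,i)·(F(i)−1)]. -/
noncomputable def P_RPS (n N : ℕ) : ℝ :=
  ((P N n * (F n - 1) : ℕ) : ℝ) / ((∑ i ∈ Finset.Icc 1 N, P N i * (F i - 1) : ℕ) : ℝ)

lemma P_eq {n i : ℕ} (h : i ≤ n) : P n i = n.descFactorial i :=
  (Nat.descFactorial_eq_div h).symm

lemma F_eq (n : ℕ) : F n = ∑ j ∈ Finset.range (n + 1), n.descFactorial j :=
  Finset.sum_congr rfl fun j hj => P_eq (by have := Finset.mem_range.1 hj; omega)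

lemma F_succ (n : ℕ) : F (n + 1) = (n + 1) * F n + 1 := by
  rw [F_eq, F_eq, Finset.sum_range_succ', Finset.mul_sum]
  simp only [Nat.succ_descFactorial_succ, Nat.descFactorial_zero]

lemma F_pos (n : ℕ) : 1 ≤ F n := by
  cases n with
  | zero => simp [F, P]
  | succ n => rw [F_succ]; omega

lemma F_mono : Monotone F := by
  refine monotone_nat_of_le_succ fun n => ?_
  rw [F_succ]; nlinarith [F_pos n]

lemma F_le (n : ℕ) : F (n + 1) + 1 ≤ 3 * (n + 1).factorial := by
  induction n with
  | zero => decide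
  | succ n ih =>
    rw [F_succ, Nat.factorial_succ (n + 1)]
    nlinarith

lemma P_self (n : ℕ) : P n n = n.factorial := by simp [P]

lemma G_le {i n : ℕ} (h : i ≤ n) : (n + 1) * (F i - 1) ≤ F (n + 1) - 1 := by
  rw [F_succ, Nat.add_sub_cancel]
  exact Nat.mul_le_mul_left _ ((Nat.sub_le _ _).trans (F_mono h))

lemma D_le (n : ℕ) :
    (n + 1) * ∑ i ∈ Finset.Icc 1 n, P (n + 1) i * (F i - 1)
      ≤ 3 * (P (n + 1) (n + 1) * (F (n + 1) - 1)) := by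
  calc (n + 1) * ∑ i ∈ Finset.Icc 1 n, P (n + 1) i * (F i - 1)
      = ∑ i ∈ Finset.Icc 1 n, P (n + 1) i * ((n + 1) * (F i - 1)) := by
        rw [Finset.mul_sum]; exact Finset.sum_congr rfl fun i _ => by ring
    _ ≤ ∑ i ∈ Finset.Icc 1 n, P (n + 1) i * (F (n + 1) - 1) :=
        Finset.sum_le_sum fun i hi => Nat.mul_le_mul_left _ (G_le (Finset.mem_Icc.1 hi).2)
    _ = (∑ i ∈ Finset.Icc 1 n, P (n + 1) i) * (F (n + 1) - 1) := by rw [Finset.sum_mul]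
    _ ≤ F (n + 1) * (F (n + 1) - 1) := by
        refine Nat.mul_le_mul_right _ (Finset.sum_le_sum_of_subset ?_)
        intro i hi
        have := Finset.mem_Icc.1 hi
        exact Finset.mem_range.2 (by omega)
    _ ≤ (3 * (n + 1).factorial) * (F (n + 1) - 1) :=
        Nat.mul_le_mul_right _ (by have := F_le n; omega)
    _ = _ := by rw [P_self]; ring

lemma T_pos (n : ℕ) : 0 < P (n + 1) (n + 1) * (F (n + 1) - 1) := by
  rw [P_self, F_succ, Nat.add_sub_cancel]
  have := F_pos n
  positivity

/-- As N → ∞ the RPST distribution concentrates all probability on permutation sequences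
of maximal length n = N: lim_{N→∞} P_RPS(N|N) = 1. -/
theorem limit_P_RPS_max_length :
    Filter.Tendsto (fun N : ℕ => P_RPS N N) Filter.atTop (nhds 1) := by
  rw [← Filter.tendsto_add_atTop_iff_nat 1]
  have hl : Filter.Tendsto (fun n : ℕ => 1 - 3 * (1 / ((n : ℝ) + 1))) Filter.atTop (nhds 1) := by
    simpa using (tendsto_one_div_add_atTop_nhds_zero_nat (𝕜 := ℝ)).const_mul 3 |>.const_sub 1
  have key : ∀ n : ℕ, 1 - 3 * (1 / ((n : ℝ) + 1)) ≤ P_RPS (n + 1) (n + 1) ∧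
      P_RPS (n + 1) (n + 1) ≤ 1 := by
    intro n
    have hT := T_pos n
    have hD := D_le n
    unfold P_RPS
    rw [Finset.sum_Icc_succ_top (by omega)]
    generalize P (n + 1) (n + 1) * (F (n + 1) - 1) = T at *
    generalize ∑ i ∈ Finset.Icc 1 n, P (n + 1) i * (F i - 1) = D at *
    have hT' : (0 : ℝ) < T := by exact_mod_cast hT
    have hD' : ((n : ℝ) + 1) * D ≤ 3 * T := by exact_mod_cast hD
    have hD0 : (0 : ℝ) ≤ D := by positivity
    have hn : (0 : ℝ) < (n : ℝ) + 1 := by positivity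
    push_cast
    constructor
    · rw [le_div_iff₀ (by positivity)]
      have h1 : (D : ℝ) ≤ 3 * (1 / ((n : ℝ) + 1)) * T := by
        rw [show 3 * (1 / ((n : ℝ) + 1)) * T = 3 * T / ((n : ℝ) + 1) by ring, le_div_iff₀ hn]
        linarith
      have h2 : 0 ≤ 3 * (1 / ((n : ℝ) + 1)) * D := by positivity
      linarith
    · rw [div_le_one (by positivity)]
      linarith
  exact tendsto_of_tendsto_of_tendsto_of_le_of_le hl tendsto_const_nhds
    (fun n => (key n).1) (fun n => (key n).2)
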